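/- arXiv:1202.5018 — 5 statements merged into one kernel-verified Lean document; each statement's English description precedes it below -/
import Mathlib

section
/- Let X be an almost Hausdorff topological space. Then every singleton {x} is locally closed in X (i.e. {x} is open in its closure), and consequently X is a T0 space. -/
open Set Topology Pointwise

/-- A topological space is *almost Hausdorff* if every nonempty closed subset `A`
contains a nonempty subset that is open in `A` and Hausdorff in the subspace topology. -/
def AlmostHausdorff (X : Type*) [TopologicalSpace X] : Prop :=
  ∀ A : Set X, IsClosed A → A.Nonempty →
    ∃ U : Set X, U.Nonempty ∧ U ⊆ A ∧ (∃ O : Set X, IsOpen O ∧ U = O ∩ A) ∧ T2Space U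

/-- A space in which every singleton is locally closed is `T0`. -/
theorem t0Space_of_isLocallyClosed_singleton {X : Type*} [TopologicalSpace X]
    (h : ∀ x : X, IsLocallyClosed ({x} : Set X)) : T0Space X := by
  refine ⟨fun x y hxy => ?_⟩
  obtain ⟨O, C, hO, hC, hOC⟩ := h x
  have hx : x ∈ O ∩ C := hOC ▸ mem_singleton x
  have hy : y ∈ ({x} : Set X) :=
    hOC ▸ ⟨(hxy.mem_open_iff hO).1 hx.1, (hxy.mem_closed_iff hC).1 hx.2⟩
  exact hy.symm

theorem AlmostHausdorff.isLocallyClosed_singleton {X : Type*} [TopologicalSpace X]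
    (h : AlmostHausdorff X) (x : X) : IsLocallyClosed ({x} : Set X) := by
  obtain ⟨U, ⟨z, hz⟩, -, ⟨O, hO, rfl⟩, hT2⟩ :=
    h (closure {x}) isClosed_closure (singleton_nonempty x).closure
  have hxO : x ∈ O := (specializes_iff_mem_closure.2 hz.2).mem_open hO hz.1
  have hxU : x ∈ O ∩ closure {x} := ⟨hxO, subset_closure rfl⟩
  refine ⟨O, closure {x}, hO, isClosed_closure, ?_⟩
  refine Subset.antisymm (singleton_subset_iff.2 hxU) fun y hy => ?_
  have hxy : (⟨x, hxU⟩ : ↥(O ∩ closure {x})) ⤳ ⟨y, hy⟩ :=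
    (subtype_specializes_iff _ _).2 (specializes_iff_mem_closure.2 hy.2)
  exact (congrArg Subtype.val hxy.eq).symm

/-- In an almost Hausdorff space every singleton is locally closed, and
consequently the space is `T0`. -/
theorem almostHausdorff_singleton_isLocallyClosed_and_t0 {X : Type*} [TopologicalSpace X]
    (h : AlmostHausdorff X) :
    (∀ x : X, IsLocallyClosed ({x} : Set X)) ∧ T0Space X := by
  exact ⟨h.isLocallyClosed_singleton,
    t0Space_of_isLocallyClosed_singleton h.isLocallyClosed_singleton⟩
end

section
/- Let X be an almost Hausdorff topological space. Then every nonempty subset B of X (not only the closed ones) contains a nonempty subset that is open in B and Hausdorff in the subspace topology; in particular every subset of X is itself almost Hausdorff in the subspace topology. -/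
open Set Topology Pointwise

/-- In an almost Hausdorff space, *every* nonempty subset `B` contains a nonempty
subset that is open in `B` and Hausdorff in the subspace topology; in particular
every subset is itself almost Hausdorff in the subspace topology. -/
theorem almostHausdorff_subset {X : Type*} [TopologicalSpace X] (h : AlmostHausdorff X) :
    (∀ B : Set X, B.Nonempty →
      ∃ U : Set X, U.Nonempty ∧ U ⊆ B ∧ (∃ O : Set X, IsOpen O ∧ U = O ∩ B) ∧ T2Space U) ∧
    (∀ B : Set X, AlmostHausdorff B) := by
  have key : ∀ B : Set X, B.Nonempty →
      ∃ U : Set X, U.Nonempty ∧ U ⊆ B ∧ (∃ O : Set X, IsOpen O ∧ U = O ∩ B) ∧ T2Space U := by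
    intro B hB
    obtain ⟨_, ⟨x, hx⟩, -, ⟨O, hO, rfl⟩, hT⟩ := h (closure B) isClosed_closure hB.closure
    refine ⟨O ∩ B, mem_closure_iff.1 hx.2 O hO hx.1, inter_subset_right, ⟨O, hO, rfl⟩, ?_⟩
    exact (IsEmbedding.inclusion (inter_subset_inter_right O subset_closure)).t2Space
  refine ⟨key, fun B A _ hA => ?_⟩
  obtain ⟨_, hU, -, ⟨O, hO, rfl⟩, hT⟩ := key (Subtype.val '' A) (hA.image _)
  obtain ⟨_, hxO, x, hxA, rfl⟩ := hU
  refine ⟨Subtype.val ⁻¹' O ∩ A, ⟨x, hxO, hxA⟩, inter_subset_right,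
    ⟨_, hO.preimage continuous_subtype_val, rfl⟩, ?_⟩
  have hmaps : MapsTo Subtype.val (Subtype.val ⁻¹' O ∩ A) (O ∩ Subtype.val '' A) :=
    fun y hy => ⟨hy.1, mem_image_of_mem _ hy.2⟩
  exact T2Space.of_injective_continuous
    (hmaps.restrict_inj.2 Subtype.val_injective.injOn)
    (continuous_subtype_val.restrict hmaps)
end

section
/- Every almost Hausdorff topological space X contains a dense open subset U such that U is Hausdorff in the subspace topology. (If X is empty, U = ∅ works.) -/
open Set Topology Pointwise

/-- An open set is Hausdorff in the subspace topology iff its distinct points have disjoint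
neighbourhood filters in the ambient space. -/
theorem IsOpen.t2Space_coe_iff {X : Type*} [TopologicalSpace X] {U : Set X} (hU : IsOpen U) :
    T2Space U ↔ U.Pairwise (Function.onFun Disjoint 𝓝) := by
  have key (x y : U) : Disjoint (𝓝 (x : X)) (𝓝 (y : X)) ↔ Disjoint (𝓝 x) (𝓝 y) := by
    rw [← hU.isOpenEmbedding_subtypeVal.map_nhds_eq x,
      ← hU.isOpenEmbedding_subtypeVal.map_nhds_eq y, Filter.disjoint_map Subtype.val_injective]
  rw [t2Space_iff_disjoint_nhds]
  constructor
  · intro h x hx y hy hxy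
    exact (key ⟨x, hx⟩ ⟨y, hy⟩).2 (h fun e => hxy (congrArg Subtype.val e))
  · intro h x y hxy
    exact (key x y).1 (h x.2 y.2 (Subtype.coe_injective.ne hxy))

/-- Every nonempty open subset of an almost Hausdorff space contains a nonempty open
Hausdorff subset. -/
theorem AlmostHausdorff.exists_isOpen_t2_subset {X : Type*} [TopologicalSpace X]
    (h : AlmostHausdorff X) {V : Set X} (hV : IsOpen V) (hne : V.Nonempty) :
    ∃ W ⊆ V, IsOpen W ∧ W.Nonempty ∧ T2Space W := by
  obtain ⟨_, ⟨x, hx⟩, -, ⟨O, hO, rfl⟩, hT⟩ := h (closure V) isClosed_closure hne.closure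
  refine ⟨O ∩ V, inter_subset_right, hO.inter hV, mem_closure_iff.1 hx.2 O hO hx.1, ?_⟩
  have hsub : O ∩ V ⊆ O ∩ closure V := inter_subset_inter_right O subset_closure
  exact T2Space.of_injective_continuous (inclusion_injective hsub) (continuous_inclusion hsub)

/-- Every almost Hausdorff space contains a dense open subset which is Hausdorff
in the subspace topology. -/
theorem almostHausdorff_exists_dense_open_t2 {X : Type*} [TopologicalSpace X]
    (h : AlmostHausdorff X) :
    ∃ U : Set X, IsOpen U ∧ Dense U ∧ T2Space U := by
  obtain ⟨U, hU⟩ := zorn_subset {U : Set X | IsOpen U ∧ U.Pairwise (Function.onFun Disjoint 𝓝)}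
    fun c hc hchain => ⟨⋃₀ c, ⟨isOpen_sUnion fun s hs => (hc hs).1,
      (pairwise_sUnion hchain.directedOn).2 fun s hs => (hc hs).2⟩,
      fun _ => subset_sUnion_of_mem⟩
  obtain ⟨hUo, hUp⟩ := hU.prop
  refine ⟨U, hUo, ?_, hUo.t2Space_coe_iff.2 hUp⟩
  by_contra hd
  rw [dense_iff_closure_eq, ← compl_empty_iff, ← ne_eq, ← nonempty_iff_ne_empty] at hd
  obtain ⟨W, hWV, hWo, ⟨x, hx⟩, hWT⟩ :=
    h.exists_isOpen_t2_subset isClosed_closure.isOpen_compl hd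
  have hdisj : Disjoint U W :=
    (disjoint_compl_right.mono_left subset_closure).mono_right hWV
  have hmem : IsOpen (U ∪ W) ∧ (U ∪ W).Pairwise (Function.onFun Disjoint 𝓝) := by
    refine ⟨hUo.union hWo, pairwise_union_of_symm.2
      ⟨hUp, hWo.t2Space_coe_iff.1 hWT, fun a ha b hb _ => ?_⟩⟩
    exact Filter.disjoint_of_disjoint_of_mem hdisj (hUo.mem_nhds ha) (hWo.mem_nhds hb)
  have hxU : x ∈ U := hU.le_of_ge hmem subset_union_left (Or.inr hx)
  exact hdisj.le_bot ⟨hxU, hx⟩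
end

section
/- Let X be a locally quasi-compact, almost Hausdorff topological space and W a Gδ subset of X. Then W, with the subspace topology, is a Baire space. -/
open Set Topology Pointwise

/-- A space in which every nonempty open set contains a nonempty open Baire subspace is Baire. -/
theorem BaireSpace.of_forall_exists_isOpen_subset {X : Type*} [TopologicalSpace X]
    (h : ∀ U : Set X, IsOpen U → U.Nonempty →
      ∃ V : Set X, IsOpen V ∧ V.Nonempty ∧ V ⊆ U ∧ BaireSpace V) : BaireSpace X where
  baire_property f ho hd := by
    rw [dense_iff_inter_open]
    intro U hU hne
    obtain ⟨V, hV, ⟨x, hx⟩, hVU, hB⟩ := h U hU hne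
    have hdense : Dense (⋂ n, ((↑) : V → X) ⁻¹' f n) :=
      dense_iInter_of_isOpen_nat (fun n ↦ (ho n).preimage continuous_subtype_val)
        fun n ↦ (hd n).preimage hV.isOpenMap_subtype_val
    obtain ⟨y, hy⟩ := hdense.nonempty_iff.mpr ⟨⟨x, hx⟩⟩
    exact ⟨y, hVU y.2, by simpa using hy⟩

/-- A `Gδ` subset of a locally quasi-compact, almost Hausdorff space is a Baire
space in the subspace topology. -/
theorem gdelta_of_locallyQuasiCompact_almostHausdorff_baire {X : Type*}
    [TopologicalSpace X] [LocallyCompactSpace X] (h : AlmostHausdorff X)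
    (W : Set X) (hW : IsGδ W) :
    BaireSpace W := by
  refine .of_forall_exists_isOpen_subset fun U hU hne ↦ ?_
  obtain ⟨O, hO, rfl⟩ := isOpen_induced_iff.mp hU
  obtain ⟨w, hw⟩ := hne
  have hOW : (O ∩ W).Nonempty := ⟨w, hw, w.2⟩
  obtain ⟨H, ⟨y, hy⟩, -, ⟨P, hP, rfl⟩, hT2⟩ :=
    h (closure (O ∩ W)) isClosed_closure hOW.closure
  obtain ⟨z, hzP, hzO, hzW⟩ := mem_closure_iff.mp hy.2 P hP hy.1
  have : LocallyCompactSpace (P ∩ closure (O ∩ W) : Set X) :=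
    (hP.isLocallyClosed.inter isClosed_closure.isLocallyClosed).locallyCompactSpace
  have hB : BaireSpace ((↑) ⁻¹' (O ∩ W) : Set (P ∩ closure (O ∩ W) : Set X)) :=
    ((hO.isGδ.inter hW).preimage continuous_subtype_val).baireSpace_of_t2Space_locallyCompactSpace
  let e : ((↑) ⁻¹' (O ∩ W) : Set (P ∩ closure (O ∩ W) : Set X)) ≃ₜ
      ((↑) ⁻¹' (P ∩ O) : Set W) :=
    { toFun := fun x ↦ ⟨⟨x.1.1, x.2.2⟩, x.1.2.1, x.2.1⟩
      invFun := fun x ↦ ⟨⟨x.1.1, x.2.1, subset_closure ⟨x.2.2, x.1.2⟩⟩, x.2.2, x.1.2⟩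
      left_inv := fun _ ↦ rfl
      right_inv := fun _ ↦ rfl
      continuous_toFun := by fun_prop
      continuous_invFun := by fun_prop }
  exact ⟨(↑) ⁻¹' (P ∩ O), (hP.inter hO).preimage continuous_subtype_val, ⟨⟨z, hzW⟩, hzP, hzO⟩,
    fun _ hx ↦ hx.2, e.baireSpace⟩
end

section
/- Let X be a nonempty irreducible topological space that is almost Hausdorff. Then X has a unique generic point, i.e. there exists exactly one x ∈ X whose closure is all of X. -/
open Set Topology Pointwise

/-- A space that is not the union of two proper closed subsets is preirreducible. -/
theorem preirreducibleSpace_of_isClosed_cover {X : Type*} [TopologicalSpace X]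
    (h : ∀ A B : Set X, IsClosed A → IsClosed B → A ∪ B = Set.univ →
      A = Set.univ ∨ B = Set.univ) : PreirreducibleSpace X := by
  refine ⟨isPreirreducible_iff_isClosed_union_isClosed.mpr fun A B hA hB hAB => ?_⟩
  simpa only [univ_subset_iff] using h A B hA hB (univ_subset_iff.mp hAB)

/-- A Hausdorff open subset of a preirreducible space has at most one point. -/
theorem subsingleton_of_isOpen_of_t2Space {X : Type*} [TopologicalSpace X]
    [PreirreducibleSpace X] {U : Set X} (hU : IsOpen U) [T2Space U] : U.Subsingleton := by
  have hpre : IsPreirreducible (univ : Set U) := by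
    have := (PreirreducibleSpace.isPreirreducible_univ (X := X)).preimage
      hU.isOpenEmbedding_subtypeVal
    simpa using this
  rw [← subsingleton_coe, ← subsingleton_univ_iff]
  exact hpre.subsingleton

/-- A nonempty irreducible almost Hausdorff space has a unique generic point,
i.e. there is exactly one point whose closure is the whole space. -/
theorem irreducible_almostHausdorff_unique_generic_point {X : Type*}
    [TopologicalSpace X] [Nonempty X]
    (hirr : ∀ A B : Set X, IsClosed A → IsClosed B → A ∪ B = Set.univ →
      A = Set.univ ∨ B = Set.univ)
    (hX : AlmostHausdorff X) :
    ∃! x : X, closure ({x} : Set X) = Set.univ := by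
  obtain ⟨U, ⟨x, hx⟩, -, ⟨O, hO, hUO⟩, hT2⟩ := hX univ isClosed_univ univ_nonempty
  have hU : IsOpen U := by rwa [hUO, inter_univ]
  have : PreirreducibleSpace X := preirreducibleSpace_of_isClosed_cover hirr
  have hsub : U.Subsingleton := subsingleton_of_isOpen_of_t2Space hU
  refine ⟨x, ?_, fun y hy => ?_⟩
  · have hdense : Dense U := hU.dense ⟨x, hx⟩
    rwa [hsub.eq_singleton_of_mem hx, dense_iff_closure_eq] at hdense
  · obtain ⟨z, hzU, rfl⟩ := (dense_iff_closure_eq.mpr hy).inter_open_nonempty U hU ⟨x, hx⟩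
    exact hsub hzU hx
end
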